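/- Let E be a standard Borel (Polish) space, N ≥ 1, and let P be a probability measure on E^N that is exchangeable, i.e. invariant under the pushforward by every permutation of the N coordinates. Let ν be a probability measure on E, and for 1 ≤ k ≤ N let P_k denote the pushforward of P under the projection of E^N onto the first k coordinates. Then ‖P_k − ν^{⊗k}‖_TV ≤ √((2k/N) · H(P | ν^{⊗N})). -/

import Mathlib

open MeasureTheory
open scoped Classical

/-- The total variation distance between two measures:
`‖P - Q‖_TV = ⨆_{A measurable} |P(A) - Q(A)|`. -/
noncomputable def tvDist {E : Type*} [MeasurableSpace E] (P Q : Measure E) : ℝ :=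
  ⨆ A : {A : Set E // MeasurableSet A}, |(P A).toReal - (Q A).toReal|

/-- The relative entropy (Kullback–Leibler divergence) `H(P|Q) = ∫ log (dP/dQ) dP` when
`P ≪ Q` (and the integral exists), and `+∞` otherwise. -/
noncomputable def relEntropy {α : Type*} [MeasurableSpace α] (P Q : Measure α) : ENNReal :=
  if P ≪ Q ∧ Integrable (fun x => Real.log (P.rnDeriv Q x).toReal) P then
    ENNReal.ofReal (∫ x, Real.log (P.rnDeriv Q x).toReal ∂P)
  else ⊤

open InformationTheory ProbabilityTheory

theorem relEntropy_eq_klDiv {α : Type*} [MeasurableSpace α] (P Q : Measure α)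
    [IsProbabilityMeasure P] [IsProbabilityMeasure Q] : relEntropy P Q = klDiv P Q := by
  simp [relEntropy, klDiv_def, llr_def]

theorem sq_sqrt_sub_one_le_klFun {x : ℝ} (hx : 0 ≤ x) : (√x - 1) ^ 2 ≤ klFun x := by
  rcases hx.eq_or_lt with rfl | hx
  · simp [klFun_zero]
  · have hs : 0 < √x := Real.sqrt_pos.mpr hx
    have hlog : 1 - (√x)⁻¹ ≤ Real.log (√x) := Real.one_sub_inv_le_log_of_pos hs
    have hsq : √x ^ 2 = x := Real.sq_sqrt hx.le
    have hmul : x - √x ≤ x * Real.log (√x) := by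
      calc x - √x = x * (1 - (√x)⁻¹) := by
            nth_rewrite 1 3 [← hsq]
            field_simp
        _ ≤ _ := by gcongr
    rw [Real.log_sqrt hx.le] at hmul
    rw [klFun_apply]
    nlinarith

/-- A linearised form of the comparison between total variation and relative entropy: integrating
it and optimising over `d` gives Pinsker's inequality up to a constant. -/
theorem two_mul_abs_sub_one_le {x d : ℝ} (hx : 0 ≤ x) :
    2 * d * |x - 1| ≤ 2 * klFun x + d ^ 2 * (x + 1) := by
  have hkl := sq_sqrt_sub_one_le_klFun hx
  have hsq : √x ^ 2 = x := Real.sq_sqrt hx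
  have habs : |x - 1| = |√x - 1| * (√x + 1) := by
    rw [← abs_of_nonneg (add_nonneg (Real.sqrt_nonneg x) zero_le_one), ← abs_mul]
    congr 1
    nlinarith
  rw [habs]
  nlinarith [sq_nonneg (2 * |√x - 1| - d * (√x + 1)), sq_abs (√x - 1),
    mul_nonneg (sq_nonneg d) (sq_nonneg (√x - 1))]

/-- Pinsker's inequality with a non-optimal constant, on a single event. -/
theorem sq_measureReal_sub_le_toReal_klDiv {α : Type*} [MeasurableSpace α] {P Q : Measure α}
    [IsProbabilityMeasure P] [IsProbabilityMeasure Q] (h : klDiv P Q ≠ ⊤)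
    {A : Set α} (hA : MeasurableSet A) :
    (P.real A - Q.real A) ^ 2 ≤ (klDiv P Q).toReal := by
  obtain ⟨hac, hint⟩ := klDiv_ne_top_iff.mp h
  set f : α → ℝ := fun x => (P.rnDeriv Q x).toReal
  have hfi : Integrable f Q := Measure.integrable_toReal_rnDeriv
  have hki : Integrable (fun x => klFun (f x)) Q := (integrable_klFun_rnDeriv_iff hac).mpr hint
  have hset : ∀ B : Set α, ∫ x in B, (f x - 1) ∂Q = P.real B - Q.real B := by
    intro B
    rw [integral_sub hfi.integrableOn (integrable_const _).integrableOn,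
      Measure.setIntegral_toReal_rnDeriv hac]
    simp
  set d := P.real A - Q.real A with hd
  have hfadd : Integrable (fun x => f x + 1) Q := hfi.add (integrable_const 1)
  have hbound : ∫ x, (2 * klFun (f x) + d ^ 2 * (f x + 1)) ∂Q
      = 2 * (klDiv P Q).toReal + 2 * d ^ 2 := by
    rw [integral_add (hki.const_mul 2) (hfadd.const_mul _),
      integral_const_mul, integral_const_mul, integral_add hfi (integrable_const 1),
      toReal_klDiv_eq_integral_klFun hac, Measure.integral_toReal_rnDeriv hac]
    simp
    ring
  have hgi : Integrable (fun x => 2 * klFun (f x) + d ^ 2 * (f x + 1)) Q :=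
    (hki.const_mul 2).add (hfadd.const_mul _)
  have hfsub : Integrable (fun x => f x - 1) Q := hfi.sub (integrable_const 1)
  have hmono : ∀ (c : ℝ), |c| = |2 * d| → ∀ B : Set α,
      c * (P.real B - Q.real B) ≤ ∫ x in B, (2 * klFun (f x) + d ^ 2 * (f x + 1)) ∂Q := by
    intro c hc B
    rw [← hset B, ← integral_const_mul]
    refine integral_mono (hfsub.const_mul c).integrableOn hgi.integrableOn fun x => ?_
    have hx := two_mul_abs_sub_one_le (x := f x) (d := |d|) ENNReal.toReal_nonneg
    calc c * (f x - 1) ≤ |c| * |f x - 1| := by rw [← abs_mul]; exact le_abs_self _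
      _ = 2 * |d| * |f x - 1| := by rw [hc, abs_mul, abs_two]
      _ ≤ _ := by simpa using hx
  have h₁ := hmono (2 * d) rfl A
  have h₂ := hmono (-(2 * d)) (abs_neg _) Aᶜ
  rw [probReal_compl_eq_one_sub hA, probReal_compl_eq_one_sub hA] at h₂
  have hsum := integral_add_compl hA hgi
  rw [hbound] at hsum
  rw [← hd] at h₁
  have hd' : 1 - P.real A - (1 - Q.real A) = -d := by rw [hd]; ring
  rw [hd'] at h₂
  nlinarith

theorem ofReal_tvDist_le_klDiv_rpow {α : Type*} [MeasurableSpace α] (P Q : Measure α)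
    [IsProbabilityMeasure P] [IsProbabilityMeasure Q] :
    ENNReal.ofReal (tvDist P Q) ≤ klDiv P Q ^ (1 / 2 : ℝ) := by
  by_cases h : klDiv P Q = ⊤
  · simp [h]
  · have htv : tvDist P Q ≤ √(klDiv P Q).toReal := by
      have : Nonempty {A : Set α // MeasurableSet A} := ⟨⟨∅, MeasurableSet.empty⟩⟩
      exact ciSup_le fun A =>
        Real.abs_le_sqrt (sq_measureReal_sub_le_toReal_klDiv h A.2)
    rw [← ENNReal.ofReal_toReal h, ENNReal.ofReal_rpow_of_nonneg ENNReal.toReal_nonneg (by norm_num),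
      ← Real.sqrt_eq_rpow]
    exact ENNReal.ofReal_le_ofReal htv

/-- Super-additivity of relative entropy with respect to a product measure. -/
theorem klDiv_fst_add_klDiv_snd_le {α β : Type*} [MeasurableSpace α] [MeasurableSpace β]
    [StandardBorelSpace β] [Nonempty β] (ρ : Measure (α × β)) [IsProbabilityMeasure ρ]
    (μ : Measure α) [IsProbabilityMeasure μ] (ν : Measure β) [IsProbabilityMeasure ν] :
    klDiv ρ.fst μ + klDiv ρ.snd ν ≤ klDiv ρ (μ.prod ν) := by
  have hchain := klDiv_compProd_eq_add ρ.fst μ ρ.condKernel (Kernel.const α ν)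
  rw [ρ.disintegrate ρ.condKernel, Measure.compProd_const, Measure.compProd_const] at hchain
  rw [hchain]
  gcongr
  simpa [Measure.snd] using klDiv_map_le ρ (ρ.fst.prod ν) measurable_snd

theorem sum_klDiv_eval_le_klDiv_pi {β : Type*} [MeasurableSpace β] [StandardBorelSpace β]
    (m : ℕ) (ρ : Measure (Fin m → β)) [IsProbabilityMeasure ρ]
    (μ : Measure β) [IsProbabilityMeasure μ] :
    ∑ i, klDiv (ρ.map fun x => x i) μ ≤ klDiv ρ (Measure.pi fun _ => μ) := by
  induction m with
  | zero => simp
  | succ m ih =>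
    have : Nonempty β := nonempty_of_isProbabilityMeasure μ
    let e := MeasurableEquiv.piFinSuccAbove (fun _ : Fin (m + 1) => β) 0
    have : IsProbabilityMeasure (ρ.map e) :=
      Measure.isProbabilityMeasure_map e.measurable.aemeasurable
    have hpi : (Measure.pi fun _ : Fin (m + 1) => μ).map e = μ.prod (Measure.pi fun _ => μ) :=
      (measurePreserving_piFinSuccAbove (fun _ : Fin (m + 1) => μ) 0).map_eq
    have hfst : (ρ.map e).fst = ρ.map fun x => x 0 := by
      rw [Measure.fst, Measure.map_map measurable_fst e.measurable]
      rfl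
    have hsnd (i : Fin m) : (ρ.map e).snd.map (fun x => x i) = ρ.map fun x => x i.succ := by
      rw [Measure.snd, Measure.map_map measurable_snd e.measurable,
        Measure.map_map (measurable_pi_apply i) (measurable_snd.comp e.measurable)]
      rfl
    calc ∑ i, klDiv (ρ.map fun x => x i) μ
        = klDiv (ρ.map e).fst μ + ∑ i, klDiv ((ρ.map e).snd.map fun x => x i) μ := by
          rw [Fin.sum_univ_succ, hfst]
          simp_rw [hsnd]
      _ ≤ klDiv (ρ.map e).fst μ + klDiv (ρ.map e).snd (Measure.pi fun _ => μ) := by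
          gcongr
          exact ih _
      _ ≤ klDiv (ρ.map e) (μ.prod (Measure.pi fun _ => μ)) := klDiv_fst_add_klDiv_snd_le _ _ _
      _ ≤ klDiv ρ (Measure.pi fun _ => μ) := hpi ▸ klDiv_map_le _ _ e.measurable

theorem map_pi_comp_injective {E ι κ : Type*} [MeasurableSpace E] [Fintype ι] [Fintype κ]
    (ν : Measure E) [IsProbabilityMeasure ν] {g : κ → ι} (hg : g.Injective) :
    (Measure.pi fun _ : ι => ν).map (fun x i => x (g i)) = Measure.pi fun _ : κ => ν := by
  have hind := (iIndepFun_pi (μ := fun _ : ι => ν) (X := fun _ => id)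
    fun _ => aemeasurable_id).precomp hg
  refine ((iIndepFun_iff_map_fun_eq_pi_map (f := fun i (x : ι → E) => x (g i)) fun i =>
    (measurable_pi_apply (g i)).aemeasurable).mp hind).trans ?_
  congr 1
  ext1 i
  exact (measurePreserving_eval (fun _ : ι => ν) (g i)).map_eq

theorem map_pi_curry {E ι κ : Type*} [MeasurableSpace E] [Fintype ι] [Fintype κ]
    (ν : Measure E) [IsProbabilityMeasure ν] :
    (Measure.pi fun _ : ι × κ => ν).map (fun x i j => x (i, j))
      = Measure.pi fun _ : ι => Measure.pi fun _ : κ => ν := by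
  simp_rw [← Measure.infinitePi_eq_pi]
  exact Measure.infinitePi_map_curry (fun (_ : ι) (_ : κ) => ν)

theorem exists_perm_comp_eq {ι κ : Type*} [Finite ι] {f g : κ → ι}
    (hf : f.Injective) (hg : g.Injective) : ∃ σ : Equiv.Perm ι, ∀ i, σ (f i) = g i := by
  let e : {x // x ∈ Set.range f} ≃ {x // x ∈ Set.range g} :=
    (Equiv.ofInjective f hf).symm.trans (Equiv.ofInjective g hg)
  have := Fintype.ofFinite ι
  refine ⟨e.extendSubtype, fun i => ?_⟩
  rw [e.extendSubtype_apply_of_mem _ (Set.mem_range_self i)]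
  simp [e, Equiv.ofInjective_symm_apply]

/-- Marginals of an exchangeable law along injective reindexings of the same size agree. -/
theorem map_comp_injective_eq_of_exchangeable {E ι κ : Type*} [MeasurableSpace E] [Finite ι]
    {P : Measure (ι → E)}
    (hexch : ∀ σ : Equiv.Perm ι, P.map (fun x : ι → E => x ∘ σ) = P)
    {f g : κ → ι} (hf : f.Injective) (hg : g.Injective) :
    P.map (fun x i => x (g i)) = P.map (fun x i => x (f i)) := by
  obtain ⟨σ, hσ⟩ := exists_perm_comp_eq hf hg
  conv_rhs => rw [← hexch σ]
  rw [Measure.map_map (by fun_prop) (by fun_prop)]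
  congr 1
  ext x i
  simp [hσ]

/-- An exchangeable law has at least as much relative entropy, with respect to a product measure,
as `m` disjoint blocks of size `k` taken together. -/
theorem mul_klDiv_marginal_le {E : Type*} [MeasurableSpace E] [StandardBorelSpace E]
    {N k m : ℕ} (P : Measure (Fin N → E)) [IsProbabilityMeasure P]
    (hexch : ∀ σ : Equiv.Perm (Fin N), P.map (fun x : Fin N → E => x ∘ σ) = P)
    (ν : Measure E) [IsProbabilityMeasure ν] (hkN : k ≤ N) (hm : m * k ≤ N) :
    m * klDiv (P.map fun x (i : Fin k) => x (Fin.castLE hkN i)) (Measure.pi fun _ => ν)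
      ≤ klDiv P (Measure.pi fun _ => ν) := by
  let g : Fin m × Fin k → Fin N := fun p => Fin.castLE hm (finProdFinEquiv p)
  have hg : g.Injective := (Fin.castLE_injective hm).comp finProdFinEquiv.injective
  let B : (Fin N → E) → Fin m → Fin k → E := fun x i j => x (g (i, j))
  have hB : Measurable B := by fun_prop
  have hpi : (Measure.pi fun _ : Fin N => ν).map B
      = Measure.pi fun _ : Fin m => Measure.pi fun _ : Fin k => ν := by
    rw [← map_pi_curry, ← map_pi_comp_injective ν hg,
      Measure.map_map (by fun_prop) (by fun_prop)]
    rfl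
  have : IsProbabilityMeasure (P.map B) := Measure.isProbabilityMeasure_map hB.aemeasurable
  have hblock (i : Fin m) : (P.map B).map (fun x => x i)
      = P.map fun x (j : Fin k) => x (Fin.castLE hkN j) := by
    rw [Measure.map_map (by fun_prop) hB]
    exact map_comp_injective_eq_of_exchangeable hexch (Fin.castLE_injective hkN)
      (g := fun j => g (i, j)) fun a b hab => (Prod.ext_iff.mp (hg hab)).2
  have hsum := sum_klDiv_eval_le_klDiv_pi m (P.map B) (Measure.pi fun _ : Fin k => ν)
  simp_rw [hblock] at hsum
  rw [Finset.sum_const, Finset.card_univ, Fintype.card_fin, nsmul_eq_mul, ← hpi] at hsum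
  exact hsum.trans (klDiv_map_le _ _ hB)

/-- Combination of the Csiszár–Pinsker–Kullback inequality with the super-additivity of the
renormalized relative entropy for exchangeable laws:
`‖P_k - ν^⊗k‖_TV ≤ √((2k/N) H(P | ν^⊗N))`. -/
theorem statement8 {E : Type*} [MeasurableSpace E] [StandardBorelSpace E]
    (N : ℕ) (hN : 1 ≤ N) (P : Measure (Fin N → E)) [IsProbabilityMeasure P]
    (hexch : ∀ σ : Equiv.Perm (Fin N),
      Measure.map (fun x : Fin N → E => x ∘ σ) P = P)
    (ν : Measure E) [IsProbabilityMeasure ν]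
    (k : ℕ) (hk1 : 1 ≤ k) (hkN : k ≤ N) :
    ENNReal.ofReal
        (tvDist (Measure.map (fun (x : Fin N → E) (i : Fin k) => x (Fin.castLE hkN i)) P)
          (Measure.pi fun _ : Fin k => ν))
      ≤ ((2 * k / N : ENNReal) * relEntropy P (Measure.pi fun _ : Fin N => ν)) ^ (1 / 2 : ℝ) := by
  have : IsProbabilityMeasure
      (P.map fun (x : Fin N → E) (i : Fin k) => x (Fin.castLE hkN i)) :=
    Measure.isProbabilityMeasure_map (Measurable.aemeasurable (by fun_prop))
  refine (ofReal_tvDist_le_klDiv_rpow _ _).trans ?_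
  gcongr
  rw [relEntropy_eq_klDiv]
  have hblocks := mul_klDiv_marginal_le P hexch ν hkN (Nat.div_mul_le_self N k)
  set H := klDiv P (Measure.pi fun _ : Fin N => ν)
  set K := klDiv (P.map fun (x : Fin N → E) (i : Fin k) => x (Fin.castLE hkN i))
    (Measure.pi fun _ : Fin k => ν)
  have hdiv : N ≤ 2 * k * (N / k) := by
    have h₁ := Nat.div_add_mod N k
    have h₂ := Nat.mod_lt N hk1
    have h₃ : k * 1 ≤ k * (N / k) := Nat.mul_le_mul_left k (Nat.div_pos hkN hk1)
    nlinarith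
  have hN0 : (N : ENNReal) ≠ 0 := by simpa using Nat.one_le_iff_ne_zero.mp hN
  rw [mul_comm, ← mul_div_assoc, ENNReal.le_div_iff_mul_le (.inl hN0) (.inl (by simp))]
  calc K * N ≤ K * (2 * k * (N / k : ℕ)) := by
        gcongr
        exact_mod_cast hdiv
    _ = ((N / k : ℕ) * K) * (2 * k) := by ring
    _ ≤ H * (2 * k) := by gcongr
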